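/- arXiv:2401.01397 — 5 statements merged into one kernel-verified Lean document; each statement's English description precedes it below -/
import Mathlib

section
/- For all real p > 0, q > 0 and t > 0, it holds that (1/2)·f1D(t;p,q) < f1D(t;p,q/2) < f1D(t;p,q). (Interpretation: the adoption probability of the boundary node of the semi-infinite line, which equals f1D(t;p,q/2), is strictly less than that of a central node, which equals f1D(t;p,q), but strictly greater than half of it.) -/
/-- The Bass adoption level on the infinite line:
`f1D t p q = 1 - exp(-(p+q)·t + (q/p)·(1 - exp(-p·t)))`. -/
noncomputable def f1D (t p q : ℝ) : ℝ :=
  1 - Real.exp (-(p + q) * t + (q / p) * (1 - Real.exp (-p * t)))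

/-- Writing `c = t - (1 - exp (-p t)) / p`, the adoption level is
`1 - exp (-p t) * exp (-q c)`. -/
theorem f1D_eq_one_sub_mul_exp (p q t : ℝ) :
    f1D t p q =
      1 - Real.exp (-p * t) * Real.exp (-q * (t - (1 - Real.exp (-p * t)) / p)) := by
  rw [f1D, ← Real.exp_add]
  congr 2
  ring

/-- For all `p, q, t > 0`, `(1/2)·f1D(t;p,q) < f1D(t;p,q/2) < f1D(t;p,q)`. -/
theorem half_f1D_lt_f1D_half_lt_f1D (p q t : ℝ) (hp : 0 < p) (hq : 0 < q) (ht : 0 < t) :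
    (1 / 2) * f1D t p q < f1D t p (q / 2) ∧ f1D t p (q / 2) < f1D t p q := by
  have hpt : 0 < p * t := mul_pos hp ht
  have hc : 0 < t - (1 - Real.exp (-p * t)) / p := by
    rw [sub_pos, div_lt_iff₀ hp]
    have := Real.add_one_lt_exp (x := -p * t) (by linarith)
    linarith
  rw [f1D_eq_one_sub_mul_exp, f1D_eq_one_sub_mul_exp]
  set c := t - (1 - Real.exp (-p * t)) / p
  have hqc : 0 < q * c := mul_pos hq hc
  have hsq : Real.exp (-q * c) = Real.exp (-(q / 2) * c) ^ 2 := by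
    rw [← Real.exp_nat_mul]
    congr 1
    push_cast
    ring
  have ha1 : Real.exp (-p * t) < 1 := Real.exp_lt_one_iff.2 (by linarith)
  have hb1 : Real.exp (-(q / 2) * c) < 1 := Real.exp_lt_one_iff.2 (by linarith)
  rw [hsq]
  have ha := Real.exp_pos (-p * t)
  have hb := Real.exp_pos (-(q / 2) * c)
  generalize Real.exp (-p * t) = a at ha ha1 ⊢
  generalize Real.exp (-(q / 2) * c) = b at hb hb1 ⊢
  constructor
  · have : 0 < a * b ^ 2 * (1 - a) := mul_pos (by positivity) (sub_pos.2 ha1)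
    nlinarith [sq_nonneg (1 - a * b)]
  · have : 0 < a * b * (1 - b) := mul_pos (mul_pos ha hb) (sub_pos.2 hb1)
    linarith
end

section
/- Fix p > 0. For q > 0 define R_min(q) as the infimum over t > 0 of the ratio f1D(t;p,q/2)/f1D(t;p,q). Then R_min(q) tends to 1/2 as q → ∞. -/
open Filter

/-- `Rmin p q` is the infimum over `t > 0` of the ratio
`f1D(t;p,q/2) / f1D(t;p,q)` (boundary over central adoption probability). -/
noncomputable def Rmin (p q : ℝ) : ℝ :=
  sInf {r : ℝ | ∃ t : ℝ, 0 < t ∧ r = f1D t p (q / 2) / f1D t p q}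

lemma f1D_pos {t p q : ℝ} (hp : 0 < p) (hq : 0 < q) (ht : 0 < t) : 0 < f1D t p q := by
  have hpt : 0 < p * t := mul_pos hp ht
  have h : 1 - Real.exp (-p * t) ≤ p * t := by
    linarith [Real.add_one_le_exp (-p * t)]
  have h' : q / p * (1 - Real.exp (-p * t)) ≤ q * t := by
    calc q / p * (1 - Real.exp (-p * t)) ≤ q / p * (p * t) := by gcongr
      _ = q * t := by field_simp
  unfold f1D
  rw [sub_pos, Real.exp_lt_one_iff]
  linarith

lemma half_le_f1D_div {t p q : ℝ} (hp : 0 < p) (hq : 0 < q) (ht : 0 < t) :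
    1 / 2 ≤ f1D t p (q / 2) / f1D t p q := by
  rw [le_div_iff₀ (f1D_pos hp hq ht)]
  set s := Real.exp (-p * t) with hs
  set u := Real.exp (-(q / 2) * t + q / 2 / p * (1 - s)) with hu
  have h₁ : f1D t p (q / 2) = 1 - s * u := by
    rw [f1D, ← hs, hu, hs, ← Real.exp_add]
    ring_nf
  have h₂ : f1D t p q = 1 - s * (u * u) := by
    rw [f1D, ← hs, hu, hs, ← Real.exp_add, ← Real.exp_add]
    ring_nf
  have hs0 : 0 < s := Real.exp_pos _
  have hs1 : s ≤ 1 := Real.exp_le_one_iff.2 (by linarith [mul_pos hp ht])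
  rw [h₁, h₂]
  nlinarith [mul_nonneg hs0.le (sq_nonneg (1 - u))]

lemma tendsto_exp_sub_one_sub_div_sq :
    Tendsto (fun x : ℝ => (Real.exp x - 1 - x) / x ^ 2) (nhdsWithin 0 {0}ᶜ) (nhds (1 / 2)) := by
  have h := (Real.exp_sub_sum_range_succ_isLittleO_pow 2).tendsto_div_nhds_zero.mono_left
    (nhdsWithin_le_nhds (s := {0}ᶜ)) |>.add_const (1 / 2)
  rw [zero_add] at h
  refine h.congr' ?_
  filter_upwards [self_mem_nhdsWithin] with x hx
  have hx : x ≠ 0 := hx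
  simp only [Finset.sum_range_succ, Finset.sum_range_zero, Nat.factorial]
  field_simp
  push_cast
  ring

lemma tendsto_f1D_div_sqrt {p δ : ℝ} (hp : 0 < p) (hδ : 0 < δ) (κ : ℝ) :
    Tendsto (fun q : ℝ => f1D (δ / √q) p (κ * q)) atTop
      (nhds (1 - Real.exp (-(κ * p * δ ^ 2 / 2)))) := by
  have ht : Tendsto (fun q : ℝ => -p * (δ / √q)) atTop (nhds 0) := by
    simpa using (Real.tendsto_sqrt_atTop.const_div_atTop δ).const_mul (-p)
  have ht' : Tendsto (fun q : ℝ => -p * (δ / √q)) atTop (nhdsWithin 0 {0}ᶜ) := by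
    refine tendsto_nhdsWithin_iff.2 ⟨ht, ?_⟩
    filter_upwards [eventually_gt_atTop 0] with q hq
    have : 0 < √q := Real.sqrt_pos.2 hq
    have : 0 < p * (δ / √q) := by positivity
    simp only [Set.mem_compl_iff, Set.mem_singleton_iff]
    linarith
  have h := ht.sub ((tendsto_exp_sub_one_sub_div_sq.comp ht').const_mul (κ * p * δ ^ 2))
  have h' := ((Real.continuous_exp.tendsto _).comp h).const_sub 1
  rw [show 0 - κ * p * δ ^ 2 * (1 / 2) = -(κ * p * δ ^ 2 / 2) by ring] at h'
  refine h'.congr' ?_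
  filter_upwards [eventually_gt_atTop 0] with q hq
  have hs : 0 < √q := Real.sqrt_pos.2 hq
  have hsq : q = √q ^ 2 := (Real.sq_sqrt hq.le).symm
  simp only [Function.comp_apply, f1D]
  congr 2
  generalize Real.exp (-p * (δ / √q)) = E
  generalize √q = r at *
  subst hsq
  field_simp
  ring

lemma tendsto_f1D_ratio_div_sqrt {p δ : ℝ} (hp : 0 < p) (hδ : 0 < δ) :
    Tendsto (fun q : ℝ => f1D (δ / √q) p (q / 2) / f1D (δ / √q) p q) atTop
      (nhds (1 / (1 + Real.exp (-(p * δ ^ 2 / 4))))) := by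
  have h₁ := tendsto_f1D_div_sqrt hp hδ (1 / 2)
  have h₂ := tendsto_f1D_div_sqrt hp hδ 1
  have hlt : Real.exp (-(p * δ ^ 2 / 4)) < 1 := Real.exp_lt_one_iff.2 (by
    have : 0 < p * δ ^ 2 := by positivity
    linarith)
  have hpos := Real.exp_pos (-(p * δ ^ 2 / 4))
  rw [show -(1 / 2 * p * δ ^ 2 / 2) = -(p * δ ^ 2 / 4) by ring] at h₁
  rw [show -(1 * p * δ ^ 2 / 2) = -(p * δ ^ 2 / 4) + -(p * δ ^ 2 / 4) by ring,
    Real.exp_add] at h₂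
  generalize Real.exp (-(p * δ ^ 2 / 4)) = e at *
  have hne : 1 - e * e ≠ 0 := by nlinarith
  convert h₁.div h₂ hne using 2
  · simp only [one_mul, Pi.div_apply]
    congr 2
    ring
  · rw [div_eq_div_iff (by positivity) hne]
    ring

/-- For fixed `p > 0`, `Rmin p q → 1/2` as `q → ∞`. -/
theorem Rmin_tendsto_half (p : ℝ) (hp : 0 < p) :
    Tendsto (fun q : ℝ => Rmin p q) atTop (nhds (1 / 2)) := by
  refine tendsto_order.2 ⟨fun c hc => ?_, fun c hc => ?_⟩
  · filter_upwards [eventually_gt_atTop 0] with q hq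
    refine hc.trans_le (le_csInf ⟨_, 1, one_pos, rfl⟩ ?_)
    rintro _ ⟨t, ht, rfl⟩
    exact half_le_f1D_div hp hq ht
  · obtain ⟨δ, hδ, hδc⟩ : ∃ δ : ℝ, 0 < δ ∧ 1 / (1 + Real.exp (-(p * δ ^ 2 / 4))) < c := by
      have hcont : Continuous fun δ : ℝ => 1 / (1 + Real.exp (-(p * δ ^ 2 / 4))) :=
        continuous_const.div (by fun_prop) fun δ => by positivity
      have h₀ : ∀ᶠ δ in nhds (0 : ℝ), 1 / (1 + Real.exp (-(p * δ ^ 2 / 4))) < c :=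
        hcont.continuousAt.eventually_lt_const (by norm_num; linarith)
      exact ((eventually_mem_nhdsWithin (a := (0 : ℝ)) (s := Set.Ioi 0)).and
        (h₀.filter_mono nhdsWithin_le_nhds)).exists
    filter_upwards [eventually_gt_atTop 0,
      (tendsto_f1D_ratio_div_sqrt hp hδ).eventually_lt_const hδc] with q hq hqc
    refine lt_of_le_of_lt (csInf_le ⟨1 / 2, ?_⟩ ⟨δ / √q, div_pos hδ (Real.sqrt_pos.2 hq), rfl⟩) hqc
    rintro _ ⟨t, ht, rfl⟩
    exact half_le_f1D_div hp hq ht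
end

section
/- Let D ≥ 2 and let 1 ≤ M ≤ L be integers. Let C(M,L,D) be the number of lattice paths with L nodes in ℤ^D from the hyperplane {j ∈ ℤ^D : j₁ = 1} to the point (M,0,…,0). Then, with k := L − M, one has k! · C(M,L,D) ≤ (2·(D−1)·L)^k. -/
/-- `IsLatticePath D L a γ` says that `γ : Fin L → (Fin D → ℤ)` is a lattice path with
`L` nodes in `ℤ^D` starting on the hyperplane `{j : j₁ = 1}`, ending at `(a,0,…,0)`,
each step being `±` a standard basis vector (repeated vertices and edges allowed). -/
def IsLatticePath (D L : ℕ) (a : ℤ) (γ : Fin L → Fin D → ℤ) : Prop :=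
  ∃ (hL : 0 < L) (hD : 0 < D),
    γ ⟨0, hL⟩ ⟨0, hD⟩ = 1 ∧
    γ ⟨L - 1, Nat.sub_lt hL one_pos⟩ = (fun i : Fin D => if (i : ℕ) = 0 then a else 0) ∧
    ∀ i : ℕ, ∀ h : i + 1 < L,
      ∃ d : Fin D,
        γ ⟨i + 1, h⟩ - γ ⟨i, Nat.lt_of_succ_lt h⟩ = Pi.single d 1 ∨
        γ ⟨i + 1, h⟩ - γ ⟨i, Nat.lt_of_succ_lt h⟩ = -Pi.single d 1

/-- `C a L D` is the number of lattice paths with `L` nodes in `ℤ^D` from the hyperplane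
`{j : j₁ = 1}` to `(a,0,…,0)`. -/
noncomputable def pathCount (a : ℤ) (L D : ℕ) : ℕ :=
  Nat.card {γ : Fin L → Fin D → ℤ // IsLatticePath D L a γ}

/-- The lattice paths in `ℤ^(d+1)` with `n + 1` nodes from the hyperplane where the first coordinate
is `1` to the point `p`. -/
def pathsTo (d n : ℕ) (p : Fin (d + 1) → ℤ) : Set (Fin (n + 1) → Fin (d + 1) → ℤ) :=
  {γ | γ 0 0 = 1 ∧ γ (Fin.last n) = p ∧
    ∀ i : Fin n, ∃ e : Fin (d + 1),
      γ i.succ - γ i.castSucc = Pi.single e 1 ∨ γ i.succ - γ i.castSucc = -Pi.single e 1}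

/-- The coefficient of `y ^ z` in `(1 + d y) ^ (2 n)`, for an integer exponent `z`. -/
def binomialCoeff (d n : ℕ) (z : ℤ) : ℕ :=
  if z < 0 then 0 else (2 * n).choose z.toNat * d ^ z.toNat

lemma binomialCoeff_natCast (d n k : ℕ) :
    binomialCoeff d n k = (2 * n).choose k * d ^ k := by
  simp [binomialCoeff]

lemma binomialCoeff_of_neg (d n : ℕ) {z : ℤ} (hz : z < 0) : binomialCoeff d n z = 0 := by
  simp [binomialCoeff, hz]

lemma binomialCoeff_succ_ge {d : ℕ} (hd : 1 ≤ d) (n : ℕ) (z : ℤ) :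
    binomialCoeff d n z + binomialCoeff d n (z - 2) + 2 * d * binomialCoeff d n (z - 1) ≤
      binomialCoeff d (n + 1) z := by
  rcases lt_or_ge z 0 with hz | hz
  · rw [binomialCoeff_of_neg d n hz, binomialCoeff_of_neg d n (by lia : z - 2 < 0),
      binomialCoeff_of_neg d n (by lia : z - 1 < 0)]
    simp
  · lift z to ℕ using hz
    rcases z with _ | _ | k
    · rw [binomialCoeff_of_neg d n (by simp : ((0 : ℕ) : ℤ) - 2 < 0),
        binomialCoeff_of_neg d n (by simp : ((0 : ℕ) : ℤ) - 1 < 0),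
        binomialCoeff_natCast, binomialCoeff_natCast]
      simp
    · rw [binomialCoeff_of_neg d n (by simp : ((0 + 1 : ℕ) : ℤ) - 2 < 0),
        (by simp : ((0 + 1 : ℕ) : ℤ) - 1 = (0 : ℕ)),
        binomialCoeff_natCast, binomialCoeff_natCast, binomialCoeff_natCast]
      simp only [zero_add, Nat.choose_one_right, Nat.choose_zero_right, pow_zero, pow_one]
      nlinarith
    · rw [(by push_cast; ring : ((k + 1 + 1 : ℕ) : ℤ) - 2 = (k : ℕ)),
        (by push_cast; ring : ((k + 1 + 1 : ℕ) : ℤ) - 1 = (k + 1 : ℕ)),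
        binomialCoeff_natCast, binomialCoeff_natCast, binomialCoeff_natCast,
        binomialCoeff_natCast]
      have hpascal : (2 * (n + 1)).choose (k + 1 + 1) =
          (2 * n).choose k + 2 * (2 * n).choose (k + 1) + (2 * n).choose (k + 1 + 1) := by
        rw [(by ring : 2 * (n + 1) = 2 * n + 1 + 1), Nat.choose_succ_succ,
          Nat.choose_succ_succ, Nat.choose_succ_succ (2 * n) (k + 1)]
        ring
      have hpow : d ^ k ≤ d ^ (k + 1 + 1) := Nat.pow_le_pow_right hd (by lia)
      have hmul := Nat.mul_le_mul_left ((2 * n).choose k) hpow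
      rw [hpascal]
      calc _ ≤ (2 * n).choose (k + 1 + 1) * d ^ (k + 1 + 1) +
            (2 * n).choose k * d ^ (k + 1 + 1) +
            2 * d * ((2 * n).choose (k + 1) * d ^ (k + 1)) := by gcongr
        _ = _ := by ring

lemma pathsTo_succ_subset (d n : ℕ) (p : Fin (d + 1) → ℤ) :
    pathsTo d (n + 1) p ⊆
      (⋃ e : Fin (d + 1), (fun γ => Fin.snoc γ p) '' pathsTo d n (p - Pi.single e 1)) ∪
      (⋃ e : Fin (d + 1), (fun γ => Fin.snoc γ p) '' pathsTo d n (p + Pi.single e 1)) := by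
  rintro γ ⟨h0, hlast, hstep⟩
  have hinit (q : Fin (d + 1) → ℤ) (hq : γ (Fin.last n).castSucc = q) :
      Fin.init γ ∈ pathsTo d n q :=
    ⟨h0, hq, fun i => hstep i.castSucc⟩
  have hsnoc : (Fin.snoc (Fin.init γ) p : Fin (n + 1 + 1) → Fin (d + 1) → ℤ) = γ := by
    rw [← hlast]
    exact Fin.snoc_init_self γ
  obtain ⟨e, he | he⟩ := hstep (Fin.last n)
  all_goals rw [Fin.succ_last, hlast] at he
  · exact Or.inl (Set.mem_iUnion.2 ⟨e, _, hinit _ (by rw [← he]; abel), hsnoc⟩)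
  · refine Or.inr (Set.mem_iUnion.2 ⟨e, _, hinit _ ?_, hsnoc⟩)
    rw [← neg_eq_iff_eq_neg] at he
    rw [← he]; abel

lemma encard_pathsTo_le {d : ℕ} (hd : 1 ≤ d) (n : ℕ) (p : Fin (d + 1) → ℤ) :
    (pathsTo d n p).encard ≤ (binomialCoeff d n (n + 1 - p 0) : ℕ) := by
  induction n generalizing p with
  | zero =>
    by_cases hp : p 0 = 1
    · have hone : binomialCoeff d 0 ((0 : ℕ) + 1 - p 0) = 1 := by simp [binomialCoeff, hp]
      rw [hone, Nat.cast_one, Set.encard_le_one_iff]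
      rintro γ δ ⟨-, hγ, -⟩ ⟨-, hδ, -⟩
      ext1 i
      rw [(by lia : i = Fin.last 0), hγ, hδ]
    · have hempty : pathsTo d 0 p = ∅ := by
        ext γ
        simp only [Set.mem_empty_iff_false, iff_false]
        rintro ⟨h0, rfl, -⟩
        exact hp h0
      simp [hempty]
  | succ n ih =>
    have hup (q : Fin (d + 1) → ℤ) (z : ℤ) (hz : n + 1 - q 0 = z) :
        ((fun γ => (Fin.snoc γ p : Fin (n + 1 + 1) → Fin (d + 1) → ℤ)) ''
          pathsTo d n q).encard ≤ (binomialCoeff d n z : ℕ) :=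
      hz ▸ (Set.encard_image_le _ _).trans (ih q)
    set z : ℤ := ((n + 1 : ℕ) : ℤ) + 1 - p 0 with hz
    push_cast at hz
    have hbound := binomialCoeff_succ_ge hd n z
    calc (pathsTo d (n + 1) p).encard
        ≤ _ := Set.encard_le_encard (pathsTo_succ_subset d n p)
      _ ≤ _ := Set.encard_union_le _ _
      _ ≤ _ := add_le_add (Set.encard_iUnion_le_of_fintype _) (Set.encard_iUnion_le_of_fintype _)
      _ ≤ (((binomialCoeff d n z : ℕ) : ℕ∞) + ∑ _i : Fin d, ((binomialCoeff d n (z - 1) : ℕ) : ℕ∞)) +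
          (((binomialCoeff d n (z - 2) : ℕ) : ℕ∞) +
            ∑ _i : Fin d, ((binomialCoeff d n (z - 1) : ℕ) : ℕ∞)) := by
        rw [Fin.sum_univ_succ, Fin.sum_univ_succ]
        refine add_le_add (add_le_add (hup _ _ ?_) (Finset.sum_le_sum fun i _ => hup _ _ ?_))
          (add_le_add (hup _ _ ?_) (Finset.sum_le_sum fun i _ => hup _ _ ?_))
        all_goals simp [hz]
        all_goals ring
      _ = ((binomialCoeff d n z + binomialCoeff d n (z - 2) +
          2 * d * binomialCoeff d n (z - 1) : ℕ) : ℕ∞) := by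
        rw [Finset.sum_const, Finset.card_univ, Fintype.card_fin, nsmul_eq_mul]
        norm_cast
        ring
      _ ≤ _ := by exact_mod_cast hbound

lemma mem_pathsTo_of_isLatticePath {d n : ℕ} {a : ℤ} {γ : Fin (n + 1) → Fin (d + 1) → ℤ}
    (h : IsLatticePath (d + 1) (n + 1) a γ) :
    γ ∈ pathsTo d n (fun i => if (i : ℕ) = 0 then a else 0) := by
  obtain ⟨_, _, h0, hlast, hstep⟩ := h
  exact ⟨h0, hlast, fun i => hstep i (Nat.succ_lt_succ i.isLt)⟩

lemma pathCount_le_choose {d : ℕ} (hd : 1 ≤ d) {n k : ℕ} {a : ℤ} (ha : a + k = n + 1) :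
    pathCount a (n + 1) (d + 1) ≤ (2 * n).choose k * d ^ k := by
  have hle := encard_pathsTo_le hd n (fun i => if (i : ℕ) = 0 then a else 0)
  have hk : (n : ℤ) + 1 - (if ((0 : Fin (d + 1)) : ℕ) = 0 then a else 0) = k := by
    simp; lia
  rw [hk, binomialCoeff_natCast] at hle
  have hsub : {γ | IsLatticePath (d + 1) (n + 1) a γ} ⊆ _ :=
    fun γ hγ => mem_pathsTo_of_isLatticePath hγ
  have hle' := (Set.encard_le_encard hsub).trans hle
  have hcast := (Set.finite_of_encard_le_coe hle').cast_ncard_eq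
  rw [← hcast] at hle'
  exact_mod_cast hle'

/-- For `D ≥ 2`, `1 ≤ M ≤ L` and `k = L − M`: `k! · C(M,L,D) ≤ (2·(D−1)·L)^k`. -/
theorem pathCount_le (D M L : ℕ) (hD : 2 ≤ D) (hM : 1 ≤ M) (hML : M ≤ L) :
    Nat.factorial (L - M) * pathCount (M : ℤ) L D ≤ (2 * (D - 1) * L) ^ (L - M) := by
  obtain ⟨d, rfl⟩ : ∃ d, D = d + 1 := ⟨D - 1, by lia⟩
  obtain ⟨n, rfl⟩ : ∃ n, L = n + 1 := ⟨L - 1, by lia⟩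
  obtain ⟨k, hk⟩ : ∃ k, n + 1 = M + k := ⟨n + 1 - M, by lia⟩
  have hsub : n + 1 - M = k := by lia
  rw [hsub, Nat.add_sub_cancel]
  calc k.factorial * pathCount (M : ℤ) (n + 1) (d + 1)
      ≤ k.factorial * ((2 * n).choose k * d ^ k) :=
        Nat.mul_le_mul_left _ (pathCount_le_choose (by lia) (by lia))
    _ = (2 * n).descFactorial k * d ^ k := by
        rw [Nat.descFactorial_eq_factorial_mul_choose, mul_assoc]
    _ ≤ (2 * n) ^ k * d ^ k := Nat.mul_le_mul_right _ (Nat.descFactorial_le_pow _ _)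
    _ = (2 * d * n) ^ k := by rw [← mul_pow]; ring
    _ ≤ (2 * d * (n + 1)) ^ k := by gcongr; lia
end

section
/- Let D = 2 and let 1 ≤ M ≤ L be integers. Then the number of lattice paths with L nodes in ℤ² from the line {j ∈ ℤ² : j₁ = 1} to (M,0) equals the binomial coefficient (2L−2 choose L−M), i.e., C(M,L,2) = Nat.choose (2L−2) (L−M). -/
/-- The step of a planar lattice path encoded by the membership of `(i, true)` and `(i, false)`
in `S`. -/
def planarStep (S : Finset (ℕ × Bool)) (i : ℕ) : Fin 2 → ℤ :=
  ![1 - (if (i, true) ∈ S then 1 else 0) - (if (i, false) ∈ S then 1 else 0),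
    (if (i, false) ∈ S then 1 else 0) - (if (i, true) ∈ S then 1 else 0)]

/-- The planar path with `n` steps encoded by `S` that ends at `(a, 0)`. -/
def planarPath (a : ℤ) (n : ℕ) (S : Finset (ℕ × Bool)) (k : Fin (n + 1)) : Fin 2 → ℤ :=
  ![a, 0] - ∑ i ∈ Finset.range n, planarStep S i + ∑ i ∈ Finset.range k, planarStep S i

lemma planarStep_eq_single (S : Finset (ℕ × Bool)) (i : ℕ) :
    ∃ d : Fin 2, planarStep S i = Pi.single d 1 ∨ planarStep S i = -Pi.single d 1 := by
  by_cases h₁ : (i, true) ∈ S <;> by_cases h₂ : (i, false) ∈ S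
  · exact ⟨0, Or.inr (by ext j; fin_cases j <;> simp [planarStep, h₁, h₂])⟩
  · exact ⟨1, Or.inr (by ext j; fin_cases j <;> simp [planarStep, h₁, h₂])⟩
  · exact ⟨1, Or.inl (by ext j; fin_cases j <;> simp [planarStep, h₁, h₂])⟩
  · exact ⟨0, Or.inl (by ext j; fin_cases j <;> simp [planarStep, h₁, h₂])⟩

lemma mem_of_planarStep_eq {S T : Finset (ℕ × Bool)} {i : ℕ}
    (h : planarStep S i = planarStep T i) (b : Bool) : (i, b) ∈ S ↔ (i, b) ∈ T := by
  have h₀ := congrFun h 0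
  have h₁ := congrFun h 1
  simp only [planarStep, Matrix.cons_val_zero, Matrix.cons_val_one] at h₀ h₁
  cases b <;> split_ifs at h₀ h₁ <;> simp_all

lemma sum_planarStep_zero {n : ℕ} {S : Finset (ℕ × Bool)}
    (hS : S ⊆ Finset.range n ×ˢ Finset.univ) :
    (∑ i ∈ Finset.range n, planarStep S i) 0 = n - S.card := by
  have hcard : (S.card : ℤ) = ∑ i ∈ Finset.range n,
      ((if (i, true) ∈ S then 1 else 0) + (if (i, false) ∈ S then 1 else 0)) := by
    have h : S = (Finset.range n ×ˢ Finset.univ).filter (· ∈ S) := by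
      rw [Finset.filter_mem_eq_inter, Finset.inter_eq_right.2 hS]
    conv_lhs => rw [h, Finset.card_filter, Finset.sum_product]
    simp only [Fintype.sum_bool]
    push_cast
    rfl
  rw [hcard, Finset.sum_apply]
  simp [planarStep, Finset.sum_add_distrib, Finset.sum_sub_distrib, sub_sub]

lemma planarPath_succ_sub (a : ℤ) {n : ℕ} (S : Finset (ℕ × Bool)) {i : ℕ} (h : i + 1 < n + 1) :
    planarPath a n S ⟨i + 1, h⟩ - planarPath a n S ⟨i, Nat.lt_of_succ_lt h⟩ = planarStep S i := by
  simp only [planarPath, Finset.sum_range_succ]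
  abel

lemma planarPath_last (a : ℤ) (n : ℕ) (S : Finset (ℕ × Bool)) (h : n < n + 1) :
    planarPath a n S ⟨n, h⟩ = ![a, 0] := by
  simp [planarPath]

lemma planarPath_zero_zero (a : ℤ) {n : ℕ} {S : Finset (ℕ × Bool)}
    (hS : S ⊆ Finset.range n ×ˢ Finset.univ) (h : 0 < n + 1) :
    planarPath a n S ⟨0, h⟩ 0 = a - (n - S.card) := by
  rw [← sum_planarStep_zero hS]
  simp only [planarPath, Pi.add_apply, Pi.sub_apply, Finset.range_zero, Finset.sum_empty,
    Pi.zero_apply, Matrix.cons_val_zero, add_zero]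

lemma ite_fin_two_eq (a : ℤ) : (fun i : Fin 2 => if (i : ℕ) = 0 then a else 0) = ![a, 0] := by
  ext i; fin_cases i <;> simp

lemma isLatticePath_planarPath {a : ℤ} {n : ℕ} {S : Finset (ℕ × Bool)}
    (hS : S ⊆ Finset.range n ×ˢ Finset.univ) (hcard : (S.card : ℤ) = n + 1 - a) :
    IsLatticePath 2 (n + 1) a (planarPath a n S) := by
  refine ⟨n.succ_pos, two_pos, ?_, ?_, fun i h => ?_⟩
  · exact (planarPath_zero_zero a hS _).trans (by rw [hcard]; ring)
  · rw [ite_fin_two_eq]; exact planarPath_last a n S _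
  · rw [planarPath_succ_sub]; exact planarStep_eq_single S i

lemma eq_of_planarPath_eq {a : ℤ} {n : ℕ} {S T : Finset (ℕ × Bool)}
    (hS : S ⊆ Finset.range n ×ˢ Finset.univ) (hT : T ⊆ Finset.range n ×ˢ Finset.univ)
    (h : planarPath a n S = planarPath a n T) : S = T := by
  have key : ∀ i < n, ∀ b, (i, b) ∈ S ↔ (i, b) ∈ T := fun i hi b => by
    refine mem_of_planarStep_eq ?_ b
    rw [← planarPath_succ_sub a S (Nat.succ_lt_succ hi), h, planarPath_succ_sub]
  ext ⟨i, b⟩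
  by_cases hi : i < n
  · exact key i hi b
  · have hn : (i, b) ∉ Finset.range n ×ˢ (Finset.univ : Finset Bool) := by simpa using hi
    exact iff_of_false (fun h' => hn (hS h')) (fun h' => hn (hT h'))

lemma exists_planarPath_eq {a : ℤ} {n : ℕ} {γ : Fin (n + 1) → Fin 2 → ℤ}
    (hγ : IsLatticePath 2 (n + 1) a γ) :
    ∃ S ⊆ Finset.range n ×ˢ (Finset.univ : Finset Bool),
      (S.card : ℤ) = n + 1 - a ∧ planarPath a n S = γ := by
  obtain ⟨_, _, h0, hlast, hstep⟩ := hγ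
  rw [ite_fin_two_eq] at hlast
  let d : ℕ → Fin 2 → ℤ := fun i => γ (Fin.ofNat (n + 1) (i + 1)) - γ (Fin.ofNat (n + 1) i)
  have hd : ∀ i (h : i + 1 < n + 1),
      d i = γ ⟨i + 1, h⟩ - γ ⟨i, Nat.lt_of_succ_lt h⟩ := fun i h => by
    have h₁ : Fin.ofNat (n + 1) (i + 1) = ⟨i + 1, h⟩ := Fin.ext (Nat.mod_eq_of_lt h)
    have h₂ : Fin.ofNat (n + 1) i = ⟨i, Nat.lt_of_succ_lt h⟩ :=
      Fin.ext (Nat.mod_eq_of_lt (Nat.lt_of_succ_lt h))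
    simp only [d, h₁, h₂]
  let S : Finset (ℕ × Bool) := (Finset.range n ×ˢ Finset.univ).filter
    fun p => if p.2 then d p.1 0 + d p.1 1 = -1 else d p.1 1 - d p.1 0 = 1
  have hS : S ⊆ Finset.range n ×ˢ Finset.univ := Finset.filter_subset _ _
  have hSd : ∀ i (h : i + 1 < n + 1),
      planarStep S i = γ ⟨i + 1, h⟩ - γ ⟨i, Nat.lt_of_succ_lt h⟩ := fun i h => by
    have hi : i < n := Nat.lt_of_succ_lt_succ h
    have ht : (i, true) ∈ S ↔ d i 0 + d i 1 = -1 := by simp [S, hi]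
    have hf : (i, false) ∈ S ↔ d i 1 - d i 0 = 1 := by simp [S, hi]
    obtain ⟨e, he⟩ := hstep i h
    rw [← hd i h] at he ⊢
    simp only [planarStep, ht, hf]
    ext j
    fin_cases e <;> rcases he with he | he <;> rw [he] <;> fin_cases j <;> simp
  have hpath : planarPath a n S = γ := by
    have hrev : ∀ k (hk : k < n + 1), planarPath a n S ⟨k, hk⟩ = γ ⟨k, hk⟩ := fun k hk => by
      induction Nat.le_of_lt_succ hk using Nat.decreasingInduction with
      | self => rw [planarPath_last]; exact hlast.symm
      | of_succ i hi ih =>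
        have h := (planarPath_succ_sub a S (Nat.succ_lt_succ hi)).trans
          (hSd i (Nat.succ_lt_succ hi))
        rw [ih (Nat.succ_lt_succ hi)] at h
        exact sub_right_injective h
    exact funext fun k => hrev k k.2
  refine ⟨S, hS, ?_, hpath⟩
  have h := planarPath_zero_zero a hS n.succ_pos
  rw [hpath] at h
  have h1 : (1 : ℤ) = a - (n - S.card) := h0.symm.trans h
  linarith

/-- In dimension `D = 2`: `C(M,L,2) = (2L−2 choose L−M)` for `1 ≤ M ≤ L`. -/
theorem pathCount_two_dim (M L : ℕ) (hM : 1 ≤ M) (hML : M ≤ L) :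
    pathCount (M : ℤ) L 2 = Nat.choose (2 * L - 2) (L - M) := by
  obtain ⟨n, rfl⟩ : ∃ n, L = n + 1 := ⟨L - 1, by omega⟩
  let P := Finset.powersetCard (n + 1 - M) (Finset.range n ×ˢ (Finset.univ : Finset Bool))
  have hP : ∀ S, S ∈ P ↔ S ⊆ Finset.range n ×ˢ Finset.univ ∧ (S.card : ℤ) = n + 1 - M :=
    fun S => by
      rw [Finset.mem_powersetCard]
      refine and_congr_right fun _ => ?_
      omega
  let f : P → {γ : Fin (n + 1) → Fin 2 → ℤ // IsLatticePath 2 (n + 1) M γ} := fun S =>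
    ⟨planarPath M n S, isLatticePath_planarPath ((hP S).1 S.2).1 ((hP S).1 S.2).2⟩
  have hf : Function.Bijective f := by
    refine ⟨fun S T h => Subtype.ext ?_, fun γ => ?_⟩
    · exact eq_of_planarPath_eq ((hP S).1 S.2).1 ((hP T).1 T.2).1 (congrArg Subtype.val h)
    · obtain ⟨S, hS, hcard, h⟩ := exists_planarPath_eq γ.2
      exact ⟨⟨S, (hP S).2 ⟨hS, hcard⟩⟩, Subtype.ext h⟩
  rw [pathCount, ← Nat.card_eq_of_bijective f hf, Nat.card_eq_fintype_card, Fintype.card_coe,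
    Finset.card_powersetCard, Finset.card_product, Finset.card_range, Finset.card_univ,
    Fintype.card_bool]
  congr 1
  omega
end

section
/- Fix real p > 0 and real α > 1, and for q > 0 set t(q) := p^{−1/(1+α)} · q^{−α/(1+α)}. Then f1D(t(q);p,q) / (p·t(q) + q·p·t(q)²/2) tends to 1 as q → ∞. -/
open Filter

/-- Quantitative second-order expansion of `f1D` for small `t`. -/
theorem abs_f1D_div_sub_one_le {t p q : ℝ} (ht : 0 < t) (hp : 0 < p) (hq : 0 < q)
    (hpt : p * t ≤ 1) (hD : p * t + q * p * t ^ 2 / 2 ≤ 1 / 2) :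
    |f1D t p q / (p * t + q * p * t ^ 2 / 2) - 1| ≤
      p * t + 4 * (p * t + q * p * t ^ 2 / 2) := by
  set D := p * t + q * p * t ^ 2 / 2 with hDdef
  have hx : 0 < p * t := by positivity
  have hqt : 0 < q * p * t ^ 2 / 2 := by positivity
  have hD0 : 0 < D := by positivity
  set r := Real.exp (-p * t) - (1 - p * t + (p * t) ^ 2 / 2) with hr
  have hr_le : |r| ≤ 2 / 9 * (p * t) ^ 3 := by
    have h := Real.exp_bound (x := -p * t) (n := 3)
      (by rw [neg_mul, abs_neg, abs_of_pos hx]; exact hpt) (by norm_num)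
    have habs : |-p * t| = p * t := by rw [neg_mul, abs_neg, abs_of_pos hx]
    rw [habs] at h
    norm_num [Finset.sum_range_succ, Nat.factorial] at h
    rw [hr]
    convert h using 1
    · congr 1
      rw [neg_mul]
      ring
    · ring
  set s := q / p * r with hs
  have hs_le : |s| ≤ p * t * D := by
    rw [hs, abs_mul, abs_of_pos (by positivity : 0 < q / p)]
    calc q / p * |r| ≤ q / p * (2 / 9 * (p * t) ^ 3) := by gcongr
      _ = 4 / 9 * (p * t * (q * p * t ^ 2 / 2)) := by field_simp; ring
      _ ≤ p * t * D := by nlinarith [mul_pos hx hqt]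
  have hexp : -(p + q) * t + q / p * (1 - Real.exp (-p * t)) = -(D + s) := by
    rw [hs, hr, hDdef]
    field_simp
    ring
  have hsD : |s| ≤ D := hs_le.trans (mul_le_of_le_one_left hD0.le hpt)
  obtain ⟨hs1, hs2⟩ := abs_le.mp hsD
  have hE0 : 0 ≤ D + s := by linarith
  have hquad : |Real.exp (-(D + s)) - 1 - -(D + s)| ≤ (-(D + s)) ^ 2 :=
    Real.abs_exp_sub_one_sub_id_le (by rw [abs_neg, abs_of_nonneg hE0]; linarith)
  have hmain : |f1D t p q - D| ≤ (p * t + 4 * D) * D := by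
    rw [f1D, hexp]
    obtain ⟨h1, h2⟩ := abs_le.mp hquad
    obtain ⟨h3, h4⟩ := abs_le.mp hs_le
    have hsq : (-(D + s)) ^ 2 ≤ 4 * D ^ 2 := by nlinarith
    rw [abs_le]
    constructor <;> nlinarith
  rw [div_sub_one hD0.ne', abs_div, abs_of_pos hD0, div_le_iff₀ hD0]
  exact hmain

/-- If `p t → 0` and `q t² → 0`, then `f1D` is equivalent to its second-order expansion. -/
theorem tendsto_f1D_div {p : ℝ} (hp : 0 < p) {t : ℝ → ℝ}
    (ht : ∀ᶠ q in atTop, 0 < t q) (ht0 : Tendsto t atTop (nhds 0))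
    (hqt : Tendsto (fun q => q * t q ^ 2) atTop (nhds 0)) :
    Tendsto (fun q => f1D (t q) p q / (p * t q + q * p * t q ^ 2 / 2)) atTop (nhds 1) := by
  have hx : Tendsto (fun q => p * t q) atTop (nhds 0) := by
    simpa using ht0.const_mul p
  have hD : Tendsto (fun q => p * t q + q * p * t q ^ 2 / 2) atTop (nhds 0) := by
    have h := hx.add (hqt.const_mul (p / 2))
    rw [mul_zero, add_zero] at h
    exact h.congr fun q => by ring
  have hbound : Tendsto (fun q => p * t q + 4 * (p * t q + q * p * t q ^ 2 / 2))
      atTop (nhds 0) := by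
    simpa using hx.add (hD.const_mul 4)
  rw [tendsto_iff_norm_sub_tendsto_zero]
  refine squeeze_zero' (Eventually.of_forall fun _ => norm_nonneg _) ?_ hbound
  filter_upwards [ht, eventually_gt_atTop 0, hx.eventually_le_const one_pos,
    hD.eventually_le_const one_half_pos] with q h1 h2 h3 h4
  exact abs_f1D_div_sub_one_le h1 hp h2 h3 h4

/-- Along the time scale `t(q) = p^{−1/(1+α)}·q^{−α/(1+α)}` (`α > 1`),
`f1D(t(q);p,q) / (p·t(q) + q·p·t(q)²/2) → 1` as `q → ∞`. -/
theorem f1D_asymptotics_along_talpha (p α : ℝ) (hp : 0 < p) (hα : 1 < α) :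
    Tendsto
      (fun q : ℝ =>
        f1D (p ^ (-(1 / (1 + α))) * q ^ (-(α / (1 + α)))) p q /
          (p * (p ^ (-(1 / (1 + α))) * q ^ (-(α / (1 + α))))
            + q * p * (p ^ (-(1 / (1 + α))) * q ^ (-(α / (1 + α)))) ^ 2 / 2))
      atTop (nhds 1) := by
  have hα' : 0 < 1 + α := by linarith
  have hpow : 0 < α / (1 + α) := by positivity
  refine tendsto_f1D_div (t := fun q => p ^ (-(1 / (1 + α))) * q ^ (-(α / (1 + α)))) hp ?_ ?_ ?_
  · filter_upwards [eventually_gt_atTop 0] with q hq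
    positivity
  · simpa using (tendsto_rpow_neg_atTop hpow).const_mul (p ^ (-(1 / (1 + α))))
  · have hexp : 0 < (α - 1) / (1 + α) := div_pos (by linarith) hα'
    have h := (tendsto_rpow_neg_atTop hexp).const_mul ((p ^ (-(1 / (1 + α)))) ^ 2)
    rw [mul_zero] at h
    refine h.congr' ?_
    filter_upwards [eventually_gt_atTop 0] with q hq
    have hq2 : q ^ (-((α - 1) / (1 + α))) = q * (q ^ (-(α / (1 + α)))) ^ 2 := by
      rw [← Real.rpow_mul_natCast hq.le, ← Real.rpow_one_add' hq.le]
      · congr 1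
        push_cast
        field_simp
        ring
      · push_cast
        have : 1 + -(α / (1 + α)) * 2 = -((α - 1) / (1 + α)) := by
          field_simp
          ring
        rw [this]
        exact (neg_neg_of_pos hexp).ne
    rw [hq2]
    ring
end
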